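/- Assume: (i) hat_theta_n -> theta_0 in probability; (ii) sup_{theta in cl(Theta)} |Gamma_n(theta) - Gamma(theta)| -> 0 in probability; (iii) (1/n) * sup_{theta in cl(Theta)} |third-order derivative array of H_n(theta)| is bounded in probability. Then Integral_{hat_U_n intersect A_n} hat_Z_n(u) du -> Integral_{R^q} exp( -(1/2) u^T Gamma(theta_0) u ) du in probability as n -> infinity. -/

import Mathlib

open MeasureTheory Filter Matrix

noncomputable section

/-- Convergence in probability of a sequence of real random variables to a constant. -/
def TendstoInProb {Ω : Type*} [MeasurableSpace Ω] (P : Measure Ω)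
    (X : ℕ → Ω → ℝ) (c : ℝ) : Prop :=
  ∀ ε > 0, Tendsto (fun n => P {ω | ε < |X n ω - c|}) atTop (nhds 0)

/-- Boundedness in probability (`O_p(1)`) of a sequence of real random variables. -/
def BoundedInProb {Ω : Type*} [MeasurableSpace Ω] (P : Measure Ω)
    (X : ℕ → Ω → ℝ) : Prop :=
  ∀ ε > 0, ∃ M > 0, Filter.limsup (fun n => P {ω | M < |X n ω|}) atTop ≤ ENNReal.ofReal ε

/-- The `i`-th standard basis vector of `R^q`. -/
def stdBasis (q : ℕ) (i : Fin q) : EuclideanSpace ℝ (Fin q) := EuclideanSpace.single i 1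

/-- The `(i,j)` entry of the Hessian of `f` at `θ`. -/
def hessEntry (q : ℕ) (f : EuclideanSpace ℝ (Fin q) → ℝ)
    (θ : EuclideanSpace ℝ (Fin q)) (i j : Fin q) : ℝ :=
  iteratedFDeriv ℝ 2 f θ ![stdBasis q i, stdBasis q j]

/-- Frobenius norm of a `q × q` array. -/
def frobNorm (q : ℕ) (A : Fin q → Fin q → ℝ) : ℝ :=
  Real.sqrt (∑ i, ∑ j, (A i j) ^ 2)

/-- Frobenius norm of the array of third-order partial derivatives of `f` at `θ`. -/
def thirdFrob (q : ℕ) (f : EuclideanSpace ℝ (Fin q) → ℝ)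
    (θ : EuclideanSpace ℝ (Fin q)) : ℝ :=
  Real.sqrt (∑ i, ∑ j, ∑ k,
    (iteratedFDeriv ℝ 3 f θ ![stdBasis q i, stdBasis q j, stdBasis q k]) ^ 2)


/-- The quadratic form of a square array. -/
def quadF (q : ℕ) (A : Fin q → Fin q → ℝ) (u : EuclideanSpace ℝ (Fin q)) : ℝ :=
  ∑ i, ∑ j, u i * A i j * u j

lemma quadF_cont (q : ℕ) (A : Fin q → Fin q → ℝ) : Continuous (quadF q A) := by
  unfold quadF; fun_prop

lemma quadF_smul (q : ℕ) (A : Fin q → Fin q → ℝ) (t : ℝ) (u : EuclideanSpace ℝ (Fin q)) :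
    quadF q A (t • u) = t ^ 2 * quadF q A u := by
  unfold quadF
  simp only [Finset.mul_sum, PiLp.smul_apply, smul_eq_mul]
  refine Finset.sum_congr rfl fun i _ => Finset.sum_congr rfl fun j _ => by ring

lemma quadF_sub (q : ℕ) (A B : Fin q → Fin q → ℝ) (u : EuclideanSpace ℝ (Fin q)) :
    quadF q (fun i j => A i j - B i j) u = quadF q A u - quadF q B u := by
  unfold quadF
  simp only [← Finset.sum_sub_distrib]
  refine Finset.sum_congr rfl fun i _ => Finset.sum_congr rfl fun j _ => by ring

lemma quadF_mul (q : ℕ) (A : Fin q → Fin q → ℝ) (c : ℝ) (u : EuclideanSpace ℝ (Fin q)) :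
    quadF q (fun i j => c * A i j) u = c * quadF q A u := by
  unfold quadF
  simp only [Finset.mul_sum]
  refine Finset.sum_congr rfl fun i _ => Finset.sum_congr rfl fun j _ => by ring

lemma frobNorm_nonneg (q : ℕ) (A : Fin q → Fin q → ℝ) : 0 ≤ frobNorm q A := Real.sqrt_nonneg _

lemma abs_quadF_le (q : ℕ) (A : Fin q → Fin q → ℝ) (u : EuclideanSpace ℝ (Fin q)) :
    |quadF q A u| ≤ frobNorm q A * ‖u‖ ^ 2 := by
  apply abs_le_of_sq_le_sq _ (by have := frobNorm_nonneg q A; positivity)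
  have hcs := Finset.sum_mul_sq_le_sq_mul_sq (Finset.univ : Finset (Fin q × Fin q))
    (fun p => A p.1 p.2) (fun p => u p.1 * u p.2)
  have e1 : quadF q A u = ∑ p : Fin q × Fin q, A p.1 p.2 * (u p.1 * u p.2) := by
    rw [Fintype.sum_prod_type]
    unfold quadF
    refine Finset.sum_congr rfl fun i _ => Finset.sum_congr rfl fun j _ => by ring
  have e2 : frobNorm q A ^ 2 = ∑ p : Fin q × Fin q, A p.1 p.2 ^ 2 := by
    rw [Fintype.sum_prod_type]
    unfold frobNorm
    rw [Real.sq_sqrt (by positivity)]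
  have e3 : (‖u‖ ^ 2) ^ 2 = ∑ p : Fin q × Fin q, (u p.1 * u p.2) ^ 2 := by
    rw [Fintype.sum_prod_type, EuclideanSpace.real_norm_sq_eq, sq, Finset.sum_mul_sum]
    refine Finset.sum_congr rfl fun i _ => Finset.sum_congr rfl fun j _ => by ring
  rw [mul_pow, e1, e2, e3]
  exact hcs

lemma quadF_coercive (q : ℕ) (hq : 1 ≤ q) (A : Fin q → Fin q → ℝ) (hA : (Matrix.of A).PosDef) :
    ∃ c > 0, ∀ u, c * ‖u‖ ^ 2 ≤ quadF q A u := by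
  have hpos : ∀ u : EuclideanSpace ℝ (Fin q), u ≠ 0 → 0 < quadF q A u := by
    intro u hu
    have h := hA.dotProduct_mulVec_pos (x := u.ofLp) (by simpa using hu)
    simp only [dotProduct, mulVec, Finset.mul_sum, Matrix.of_apply] at h
    unfold quadF
    refine h.trans_eq (Finset.sum_congr rfl fun i _ => Finset.sum_congr rfl fun j _ => ?_)
    simp only [Pi.star_apply, star_trivial]; ring
  have : Nonempty (Fin q) := ⟨⟨0, hq⟩⟩
  obtain ⟨v, hv, hmin⟩ := (isCompact_sphere (0 : EuclideanSpace ℝ (Fin q)) 1).exists_isMinOn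
    (NormedSpace.sphere_nonempty.2 zero_le_one) (quadF_cont q A).continuousOn
  have hv1 : ‖v‖ = 1 := by simpa using hv
  refine ⟨quadF q A v, hpos v (by rintro rfl; simp at hv1), fun u => ?_⟩
  by_cases hu : u = 0
  · subst hu; simp [quadF]
  have hn : ‖u‖ ≠ 0 := by simpa using hu
  have hm : quadF q A v ≤ quadF q A (‖u‖⁻¹ • u) := hmin (by simp [norm_smul, hn])
  rw [quadF_smul] at hm
  calc _ ≤ _ := mul_le_mul_of_nonneg_right hm (sq_nonneg ‖u‖)
    _ = _ := by field_simp

lemma fderiv2_eq_quadF (q : ℕ) (f : EuclideanSpace ℝ (Fin q) → ℝ)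
    (x h : EuclideanSpace ℝ (Fin q)) :
    fderiv ℝ (fderiv ℝ f) x h h = quadF q (hessEntry q f x) h := by
  have hh : h = ∑ i, h i • _root_.stdBasis q i := by
    ext k; simp [_root_.stdBasis, Finset.sum_apply, Pi.single_apply]
  conv_lhs => rw [hh]
  unfold quadF hessEntry
  simp only [iteratedFDeriv_two_apply, map_sum, map_smul, _root_.sum_apply,
    _root_.smul_apply, smul_eq_mul, Finset.mul_sum]
  rw [Finset.sum_comm]
  refine Finset.sum_congr rfl fun i _ => Finset.sum_congr rfl fun j _ => ?_
  simp; ring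

/-- One-dimensional second order comparison. -/
lemma taylor_upper (f f' f'' : ℝ → ℝ) (C : ℝ)
    (hf : ∀ t ∈ Set.Icc (0 : ℝ) 1, HasDerivAt f (f' t) t)
    (hf' : ∀ t ∈ Set.Icc (0 : ℝ) 1, HasDerivAt f' (f'' t) t)
    (h0 : f' 0 = 0) (hC : ∀ t ∈ Set.Icc (0 : ℝ) 1, f'' t ≤ C) :
    f 1 - f 0 ≤ C / 2 := by
  have a1 : AntitoneOn (fun t => f' t - C * t) (Set.Icc 0 1) := by
    have hd : ∀ t ∈ Set.Icc (0 : ℝ) 1, HasDerivAt (fun t => f' t - C * t) (f'' t - C) t := by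
      intro t ht
      have := (hf' t ht).sub ((hasDerivAt_id t).const_mul C)
      rw [mul_one] at this
      exact this
    refine antitoneOn_of_hasDerivWithinAt_nonpos (convex_Icc 0 1) (f' := fun t => f'' t - C)
      (fun t ht => (hd t ht).continuousAt.continuousWithinAt)
      (fun t ht => (hd t (interior_subset ht)).hasDerivWithinAt)
      (fun t ht => by have := hC t (interior_subset ht); simpa using this)
  have hle : ∀ t ∈ Set.Icc (0 : ℝ) 1, f' t - C * t ≤ 0 := by
    intro t ht
    have := a1 (Set.left_mem_Icc.2 zero_le_one) ht ht.1
    simpa [h0] using this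
  have a2 : AntitoneOn (fun t => f t - C / 2 * t ^ 2) (Set.Icc 0 1) := by
    have hd : ∀ t ∈ Set.Icc (0 : ℝ) 1,
        HasDerivAt (fun t => f t - C / 2 * t ^ 2) (f' t - C * t) t := by
      intro t ht
      have := (hf t ht).sub ((hasDerivAt_pow 2 t).const_mul (C / 2))
      have e : f' t - C / 2 * (((2 : ℕ) : ℝ) * t ^ (2 - 1)) = f' t - C * t := by
        norm_num; ring
      rw [e] at this
      exact this
    exact antitoneOn_of_hasDerivWithinAt_nonpos (convex_Icc 0 1)
      (fun t ht => (hd t ht).continuousAt.continuousWithinAt)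
      (fun t ht => (hd t (interior_subset ht)).hasDerivWithinAt)
      (fun t ht => hle t (interior_subset ht))
  have := a2 (Set.left_mem_Icc.2 zero_le_one) (Set.right_mem_Icc.2 zero_le_one) zero_le_one
  simp at this
  linarith

lemma taylor_two (q : ℕ) (f : EuclideanSpace ℝ (Fin q) → ℝ) (V : Set (EuclideanSpace ℝ (Fin q)))
    (hV : IsOpen V) (hf : ContDiffOn ℝ 3 f V) (x h : EuclideanSpace ℝ (Fin q))
    (hx : ∀ t ∈ Set.Icc (0 : ℝ) 1, x + t • h ∈ V) (h0 : fderiv ℝ f x = 0) (D C : ℝ)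
    (hC : ∀ t ∈ Set.Icc (0 : ℝ) 1, |quadF q (hessEntry q f (x + t • h)) h + D| ≤ C) :
    |f (x + h) - f x + D / 2| ≤ C / 2 := by
  have hl : ∀ t, HasDerivAt (fun t : ℝ => x + t • h) h t := by
    intro t
    simpa using ((hasDerivAt_id t).smul_const h).const_add x
  have d1 : ∀ t ∈ Set.Icc (0 : ℝ) 1,
      HasDerivAt (fun t : ℝ => f (x + t • h)) (fderiv ℝ f (x + t • h) h) t := by
    intro t ht
    have hc := (hf.contDiffAt (hV.mem_nhds (hx t ht))).differentiableAt (by norm_num)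
    exact hc.hasFDerivAt.comp_hasDerivAt t (hl t)
  have d2 : ∀ t ∈ Set.Icc (0 : ℝ) 1,
      HasDerivAt (fun t : ℝ => fderiv ℝ f (x + t • h) h)
        (quadF q (hessEntry q f (x + t • h)) h) t := by
    intro t ht
    have hc := ((hf.contDiffAt (hV.mem_nhds (hx t ht))).fderiv_right (m := 1)
      (by norm_num)).differentiableAt (by norm_num)
    have h1 := hc.hasFDerivAt.comp_hasDerivAt t (hl t)
    have h2 := ((ContinuousLinearMap.apply ℝ ℝ h).hasFDerivAt
      (x := fderiv ℝ f (x + t • h))).comp_hasDerivAt t h1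
    rw [← fderiv2_eq_quadF]
    exact h2
  have u := taylor_upper _ _ _ (C - D) d1 d2 (by simp [h0])
    (fun t ht => by have := (abs_le.1 (hC t ht)).2; linarith)
  have l := taylor_upper _ _ _ (C + D) (fun t ht => (d1 t ht).neg) (fun t ht => (d2 t ht).neg)
    (by simp [h0]) (fun t ht => by have := (abs_le.1 (hC t ht)).1; linarith)
  simp at u l
  rw [abs_le]; constructor <;> linarith

lemma integrable_gauss (q : ℕ) (b : ℝ) (hb : 0 < b) :
    Integrable (fun u : EuclideanSpace ℝ (Fin q) => Real.exp (-b * ‖u‖ ^ 2)) := by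
  have := (GaussianFourier.integrable_cexp_neg_mul_sq_norm_add (V := EuclideanSpace ℝ (Fin q))
    (b := (b : ℂ)) (by simpa using hb) 0 0).norm
  refine this.congr (Eventually.of_forall fun u => ?_)
  simp only [Complex.norm_exp]
  congr 1
  simp [← Complex.ofReal_pow]

lemma integrable_gauss' (q : ℕ) (A : Fin q → Fin q → ℝ) (c κ : ℝ)
    (hc : ∀ u, c * ‖u‖ ^ 2 ≤ quadF q A u) (hκ : κ < c) :
    Integrable (fun u => Real.exp (-(1 / 2) * quadF q A u + κ / 2 * ‖u‖ ^ 2)) := by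
  refine (integrable_gauss q ((c - κ) / 2) (by linarith)).mono' ?_ ?_
  · have := quadF_cont q A
    exact (by fun_prop : Continuous _).aestronglyMeasurable
  · refine Eventually.of_forall fun u => ?_
    rw [Real.norm_eq_abs, abs_of_pos (Real.exp_pos _), Real.exp_le_exp]
    have := hc u
    nlinarith

lemma tendsto_err (q : ℕ) (A : Fin q → Fin q → ℝ) (c : ℝ) (hc0 : 0 < c)
    (hc : ∀ u, c * ‖u‖ ^ 2 ≤ quadF q A u) :
    Tendsto (fun κ : ℝ => ∫ u, (Real.exp (-(1 / 2) * quadF q A u + κ / 2 * ‖u‖ ^ 2)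
      - Real.exp (-(1 / 2) * quadF q A u))) (nhds 0) (nhds 0) := by
  have hQ := quadF_cont q A
  have key := tendsto_integral_filter_of_dominated_convergence (μ := volume) (l := nhds (0 : ℝ))
    (F := fun κ u => (Real.exp (-(1 / 2) * quadF q A u + κ / 2 * ‖u‖ ^ 2)
      - Real.exp (-(1 / 2) * quadF q A u))) (f := fun _ => 0)
    (fun u => Real.exp (-(1 / 2) * quadF q A u + (c / 2) / 2 * ‖u‖ ^ 2)
      + Real.exp (-(1 / 2) * quadF q A u))
    (Eventually.of_forall fun κ => (by fun_prop : Continuous _).aestronglyMeasurable)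
    ?_ ?_ ?_
  · simpa using key
  · filter_upwards [Iio_mem_nhds (show (0 : ℝ) < c / 2 by linarith)] with κ hκ
    refine Eventually.of_forall fun u => (norm_sub_le _ _).trans ?_
    simp only [Real.norm_eq_abs, abs_of_pos (Real.exp_pos _)]
    have : κ < c / 2 := hκ
    gcongr
  · refine (integrable_gauss' q A c (c / 2) hc (by linarith)).add ?_
    simpa using integrable_gauss' q A c 0 hc hc0
  · refine Eventually.of_forall fun u => ?_
    have : Continuous (fun κ : ℝ => (Real.exp (-(1 / 2) * quadF q A u + κ / 2 * ‖u‖ ^ 2)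
      - Real.exp (-(1 / 2) * quadF q A u))) := by fun_prop
    simpa using this.tendsto 0

lemma le_biSup_closure {E : Type*} [TopologicalSpace E] {K : Set E} (hK : IsCompact K)
    (f : E → ℝ) (hf : ContinuousOn f K) (h0 : ∀ x, 0 ≤ f x) {x : E} (hx : x ∈ K) :
    f x ≤ ⨆ y ∈ K, f y := by
  obtain ⟨M, hM⟩ := hK.bddAbove_image hf
  have hle : ∀ y, (⨆ (_ : y ∈ K), f y) ≤ max M 0 := by
    intro y
    by_cases hy : y ∈ K
    · simp only [hy, ciSup_unique]
      exact le_max_of_le_left (hM ⟨y, hy, rfl⟩)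
    · simp [hy]
  have := le_ciSup (f := fun y => ⨆ (_ : y ∈ K), f y) ⟨max M 0, by rintro _ ⟨y, rfl⟩; exact hle y⟩ x
  simpa [hx] using this

lemma hess_cont (q : ℕ) (f : EuclideanSpace ℝ (Fin q) → ℝ) (U K : Set (EuclideanSpace ℝ (Fin q)))
    (hU : IsOpen U) (hKU : K ⊆ U) (hf : ContDiffOn ℝ 3 f U) (i j : Fin q) :
    ContinuousOn (fun θ => hessEntry q f θ i j) K := by
  intro x hx
  apply ContinuousAt.continuousWithinAt
  have h1 := hf.contDiffAt (hU.mem_nhds (hKU hx))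
  have h2 := (h1.fderiv_right (m := 2) (by norm_num)).fderiv_right (m := 1) (by norm_num)
  unfold hessEntry
  simp only [iteratedFDeriv_two_apply]
  exact (h2.continuousAt.clm_apply continuousAt_const).clm_apply continuousAt_const

/-- Deterministic integral comparison. -/
lemma integral_compare (q : ℕ) (A : Fin q → Fin q → ℝ) (c κ : ℝ) (hκ0 : 0 ≤ κ) (hκ : κ < c)
    (hc : ∀ u, c * ‖u‖ ^ 2 ≤ quadF q A u) (S : Set (EuclideanSpace ℝ (Fin q)))
    (hS : MeasurableSet S) (Z : EuclideanSpace ℝ (Fin q) → ℝ) (hZ : Measurable Z)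
    (hZb : ∀ u ∈ S, |Z u + 1 / 2 * quadF q A u| ≤ κ / 2 * ‖u‖ ^ 2) :
    |(∫ u in S, Real.exp (Z u)) - ∫ u, Real.exp (-(1 / 2) * quadF q A u)| ≤
      (∫ u, (Real.exp (-(1 / 2) * quadF q A u + κ / 2 * ‖u‖ ^ 2)
        - Real.exp (-(1 / 2) * quadF q A u)))
      + |(∫ u in S, Real.exp (-(1 / 2) * quadF q A u))
        - ∫ u, Real.exp (-(1 / 2) * quadF q A u)| := by
  have hg : Integrable (fun u => Real.exp (-(1 / 2) * quadF q A u)) := by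
    simpa using integrable_gauss' q A c 0 hc (hκ0.trans_lt hκ)
  have hg' := integrable_gauss' q A c κ hc hκ
  have hZi : IntegrableOn (fun u => Real.exp (Z u)) S := by
    refine (hg'.integrableOn (s := S)).mono' (by fun_prop) ?_
    filter_upwards [ae_restrict_mem hS] with u hu
    rw [Real.norm_eq_abs, abs_of_pos (Real.exp_pos _), Real.exp_le_exp]
    have := (abs_le.1 (hZb u hu)).2
    linarith
  refine (abs_sub_le _ (∫ u in S, Real.exp (-(1 / 2) * quadF q A u)) _).trans ?_
  gcongr
  rw [← integral_sub hZi hg.integrableOn]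
  rw [← Real.norm_eq_abs]
  refine (norm_integral_le_integral_norm _).trans ?_
  have step : (∫ u in S, ‖Real.exp (Z u) - Real.exp (-(1 / 2) * quadF q A u)‖) ≤
      ∫ u in S, (Real.exp (-(1 / 2) * quadF q A u + κ / 2 * ‖u‖ ^ 2)
        - Real.exp (-(1 / 2) * quadF q A u)) := by
    refine setIntegral_mono_on (hZi.sub hg.integrableOn).norm (hg'.sub hg).integrableOn hS ?_
    intro u hu
    have hb := abs_le.1 (hZb u hu)
    set a := -(1 / 2) * quadF q A u with ha
    set k := κ / 2 * ‖u‖ ^ 2 with hk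
    have hk0 : 0 ≤ k := by positivity
    have e1 : Real.exp (Z u) ≤ Real.exp (a + k) := Real.exp_le_exp.2 (by linarith)
    have e2 : Real.exp (a - k) ≤ Real.exp (Z u) := Real.exp_le_exp.2 (by linarith)
    have e3 : 2 * Real.exp a ≤ Real.exp (a + k) + Real.exp (a - k) := by
      rw [Real.exp_add, sub_eq_add_neg, Real.exp_add]
      have h1 : 1 ≤ Real.cosh k := Real.one_le_cosh k
      rw [Real.cosh_eq] at h1
      nlinarith [Real.exp_pos a]
    rw [Real.norm_eq_abs, abs_le]
    constructor <;> linarith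
  refine step.trans (setIntegral_le_integral (hg'.sub hg) (Eventually.of_forall fun u => ?_))
  have : 0 ≤ κ / 2 * ‖u‖ ^ 2 := by positivity
  simp only [Pi.zero_apply, Pi.sub_apply, sub_nonneg, Real.exp_le_exp]
  linarith

/-- Proposition 5.6: `∫_{Ûₙ ∩ Aₙ} Ẑₙ(u) du → ∫_{ℝ^q} exp(-(1/2) uᵀ Γ(θ₀) u) du` in probability. -/
theorem stmt2
    {Ω : Type*} [MeasurableSpace Ω] (P : Measure Ω) [IsProbabilityMeasure P]
    (q : ℕ) (hq : 1 ≤ q)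
    (Θ : Set (EuclideanSpace ℝ (Fin q)))
    (hΘne : Θ.Nonempty) (hΘbdd : Bornology.IsBounded Θ) (hΘopen : IsOpen Θ)
    (hΘconv : Convex ℝ Θ)
    (H : ℕ → Ω → EuclideanSpace ℝ (Fin q) → ℝ)
    (hHmeas : ∀ n, Measurable (fun p : Ω × EuclideanSpace ℝ (Fin q) => H n p.1 p.2))
    (hHsmooth : ∀ n ω, ∃ U : Set (EuclideanSpace ℝ (Fin q)),
      IsOpen U ∧ closure Θ ⊆ U ∧ ContDiffOn ℝ 3 (H n ω) U)
    (θhat : ℕ → Ω → EuclideanSpace ℝ (Fin q))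
    (hθhatmeas : ∀ n, Measurable (θhat n))
    (hθhatmem : ∀ n ω, θhat n ω ∈ closure Θ)
    (hθhatmax : ∀ n ω, ∀ θ ∈ closure Θ, H n ω θ ≤ H n ω (θhat n ω))
    (θ0 : EuclideanSpace ℝ (Fin q)) (hθ0 : θ0 ∈ Θ)
    (Γ : EuclideanSpace ℝ (Fin q) → Matrix (Fin q) (Fin q) ℝ)
    (hΓcont : Continuous Γ) (hΓsymm : ∀ θ, (Γ θ).IsSymm)
    (hΓ0 : (Γ θ0).PosDef)
    -- (i) θ̂ₙ → θ₀ in probability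
    (h1 : ∀ ε > 0, Tendsto (fun n => P {ω | ε < ‖θhat n ω - θ0‖}) atTop (nhds 0))
    -- (ii) sup_{θ ∈ cl Θ} |Γₙ(θ) - Γ(θ)| → 0 in probability
    (h2 : ∀ ε > 0, Tendsto (fun n : ℕ =>
      P {ω | ε < ⨆ θ ∈ closure Θ, frobNorm q (fun i j =>
        (-(1 / (n : ℝ)) * hessEntry q (H n ω) θ i j) - Γ θ i j)})
      atTop (nhds 0))
    -- (iii) (1/n) sup_{θ ∈ cl Θ} |∂³ Hₙ(θ)| is bounded in probability
    (h3 : BoundedInProb P (fun n ω => (1 / (n : ℝ)) * ⨆ θ ∈ closure Θ, thirdFrob q (H n ω) θ)) :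
    TendstoInProb P (fun n ω =>
      ∫ u in {u : EuclideanSpace ℝ (Fin q) |
            θhat n ω + ((n : ℝ) ^ (-(1 : ℝ) / 2)) • u ∈ Θ} ∩
          {u : EuclideanSpace ℝ (Fin q) | ‖u‖ ≤ (n : ℝ) ^ ((3 : ℝ) / 8)},
        Real.exp (H n ω (θhat n ω + ((n : ℝ) ^ (-(1 : ℝ) / 2)) • u) - H n ω (θhat n ω)))
      (∫ u : EuclideanSpace ℝ (Fin q),
        Real.exp (-(1 / 2) * ∑ i, ∑ j, u i * Γ θ0 i j * u j)) := by
  intro ε hε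
  set A : Fin q → Fin q → ℝ := fun i j => Γ θ0 i j with hA
  change Tendsto (fun n => P {ω | ε < |(∫ u in _, Real.exp _) -
    ∫ u, Real.exp (-(1 / 2) * quadF q A u)|}) atTop (nhds 0)
  obtain ⟨c, hc0, hc⟩ := quadF_coercive q hq A hΓ0
  -- choice of κ
  obtain ⟨r, hr0, hr⟩ := Metric.eventually_nhds_iff.1
    ((tendsto_err q A c hc0 hc).eventually (Iio_mem_nhds (half_pos hε)))
  obtain ⟨κ, hκ0, hκr, hκc⟩ : ∃ κ : ℝ, 0 < κ ∧ κ < r ∧ κ < c :=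
    ⟨min r c / 2, by positivity, by have := min_le_left r c; have := lt_min hr0 hc0; linarith,
      by have := min_le_right r c; have := lt_min hr0 hc0; linarith⟩
  have herr := hr (y := κ) (by simpa [abs_of_pos hκ0] using hκr)
  -- continuity of Γ
  have hfc : Continuous (fun θ => frobNorm q (fun i j => Γ θ i j - A i j)) := by
    unfold frobNorm
    fun_prop
  obtain ⟨δ1, hδ1, hΓδ⟩ := Metric.eventually_nhds_iff.1
    ((hfc.tendsto θ0).eventually (Iio_mem_nhds (show frobNorm q (fun i j => Γ θ0 i j - A i j)
      < κ / 2 by simp [hA, frobNorm]; exact hκ0)))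
  obtain ⟨δ2, hδ2, hΘδ⟩ := Metric.isOpen_iff.1 hΘopen θ0 hθ0
  obtain ⟨δ, hδ0, hδa, hδb⟩ : ∃ δ : ℝ, 0 < δ ∧ 2 * δ < δ1 ∧ 2 * δ < δ2 :=
    ⟨min δ1 δ2 / 3, by positivity,
      by have := min_le_left δ1 δ2; have := lt_min hδ1 hδ2; linarith,
      by have := min_le_right δ1 δ2; have := lt_min hδ1 hδ2; linarith⟩
  -- tails
  have hg : Integrable (fun u => Real.exp (-(1 / 2) * quadF q A u)) := by
    simpa using integrable_gauss' q A c 0 hc hc0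
  have hrad : Tendsto (fun n : ℕ => (n : ℝ) ^ ((3 : ℝ) / 8)) atTop atTop :=
    (tendsto_rpow_atTop (by norm_num)).comp tendsto_natCast_atTop_atTop
  have htail := (aecover_closedBall (μ := (volume : Measure (EuclideanSpace ℝ (Fin q))))
    (x := 0) hrad).integral_tendsto_of_countably_generated hg
  have htail' := Metric.tendsto_nhds.1 htail (ε / 2) (half_pos hε)
  have hsmall : Tendsto (fun n : ℕ => (n : ℝ) ^ (-((1 : ℝ) / 8))) atTop (nhds 0) :=
    (tendsto_rpow_neg_atTop (by norm_num)).comp tendsto_natCast_atTop_atTop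
  have hsmall' := hsmall.eventually (Iio_mem_nhds hδ0)
  have hlim := (h1 δ hδ0).add (h2 (κ / 2) (half_pos hκ0))
  rw [add_zero] at hlim
  refine tendsto_of_tendsto_of_tendsto_of_le_of_le' tendsto_const_nhds hlim
    (Eventually.of_forall fun n => zero_le) ?_
  filter_upwards [htail', hsmall', eventually_ge_atTop 1] with n hn1 hn2 hn3
  refine (measure_mono ?_).trans (measure_union_le _ _)
  intro ω hω
  by_contra hcon
  simp only [Set.mem_union, Set.mem_setOf_eq, not_or, not_lt] at hcon
  obtain ⟨hω1, hω2⟩ := hcon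
  have hnpos : (0 : ℝ) < n := by exact_mod_cast hn3
  have hclose : ∀ u : EuclideanSpace ℝ (Fin q), ‖u‖ ≤ (n : ℝ) ^ ((3 : ℝ) / 8) →
      ∀ t ∈ Set.Icc (0 : ℝ) 1,
      dist (θhat n ω + t • ((n : ℝ) ^ (-(1 : ℝ) / 2)) • u) θ0 ≤ 2 * δ := by
    intro u hu t ht
    have hb : ‖t • ((n : ℝ) ^ (-(1 : ℝ) / 2)) • u‖ ≤ δ := by
      rw [norm_smul, norm_smul, Real.norm_eq_abs, Real.norm_eq_abs, abs_of_nonneg ht.1,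
        abs_of_pos (Real.rpow_pos_of_pos hnpos _)]
      have e : (n : ℝ) ^ (-(1 : ℝ) / 2) * (n : ℝ) ^ ((3 : ℝ) / 8) = (n : ℝ) ^ (-((1 : ℝ) / 8)) := by
        rw [← Real.rpow_add hnpos]; norm_num
      have hle : (n : ℝ) ^ (-(1 : ℝ) / 2) * ‖u‖ ≤ (n : ℝ) ^ (-((1 : ℝ) / 8)) := by
        rw [← e]; gcongr
      have hn2' : (n : ℝ) ^ (-((1 : ℝ) / 8)) < δ := hn2
      have h0' : 0 ≤ (n : ℝ) ^ (-(1 : ℝ) / 2) * ‖u‖ := by positivity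
      calc t * ((n : ℝ) ^ (-(1 : ℝ) / 2) * ‖u‖) ≤ 1 * ((n : ℝ) ^ (-(1 : ℝ) / 2) * ‖u‖) := by
            gcongr; exact ht.2
        _ ≤ δ := by linarith
    rw [dist_eq_norm, add_sub_right_comm]
    exact (norm_add_le _ _).trans (by linarith)
  have hin : ∀ θ, dist θ θ0 ≤ 2 * δ → θ ∈ Θ := fun θ hθ =>
    hΘδ (Metric.mem_ball.2 (hθ.trans_lt hδb))
  have hset : {u : EuclideanSpace ℝ (Fin q) |
            θhat n ω + ((n : ℝ) ^ (-(1 : ℝ) / 2)) • u ∈ Θ} ∩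
          {u : EuclideanSpace ℝ (Fin q) | ‖u‖ ≤ (n : ℝ) ^ ((3 : ℝ) / 8)} =
      Metric.closedBall 0 ((n : ℝ) ^ ((3 : ℝ) / 8)) := by
    ext u
    simp only [Set.mem_inter_iff, Set.mem_setOf_eq, mem_closedBall_zero_iff,
      and_iff_right_iff_imp]
    intro hu
    have := hclose u hu 1 (Set.right_mem_Icc.2 zero_le_one)
    rw [one_smul] at this
    exact hin _ this
  obtain ⟨U, hUo, hΘU, hHU⟩ := hHsmooth n ω
  have hθin : θhat n ω ∈ Θ := hin _ (by rw [dist_eq_norm]; linarith)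
  have hgrad : fderiv ℝ (H n ω) (θhat n ω) = 0 := by
    apply IsLocalMax.fderiv_eq_zero
    filter_upwards [hΘopen.mem_nhds hθin] with θ hθ
    exact hθhatmax n ω θ (subset_closure hθ)
  have hHm : Measurable (H n ω) := (hHmeas n).comp measurable_prodMk_left
  have hK : IsCompact (closure Θ) := hΘbdd.isCompact_closure
  have hG : ∀ θ ∈ closure Θ, frobNorm q (fun i j =>
        (-(1 / (n : ℝ)) * hessEntry q (H n ω) θ i j) - Γ θ i j) ≤ κ / 2 := by
    intro θ hθ
    refine (le_biSup_closure hK (fun θ => frobNorm q (fun i j =>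
        (-(1 / (n : ℝ)) * hessEntry q (H n ω) θ i j) - Γ θ i j)) ?_
      (fun _ => frobNorm_nonneg _ _) hθ).trans hω2
    unfold frobNorm
    have hh := hess_cont q (H n ω) U (closure Θ) hUo hΘU hHU
    have hΓ' : ∀ i j, Continuous (fun θ => Γ θ i j) := fun i j => by fun_prop
    refine ContinuousOn.sqrt (continuousOn_finsetSum _ fun i _ => continuousOn_finsetSum _ fun j _ => ?_)
    exact ((continuousOn_const.mul (hh i j)).sub (hΓ' i j).continuousOn).pow 2
  have hZb : ∀ u ∈ Metric.closedBall (0 : EuclideanSpace ℝ (Fin q)) ((n : ℝ) ^ ((3 : ℝ) / 8)),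
      |(H n ω (θhat n ω + ((n : ℝ) ^ (-(1 : ℝ) / 2)) • u) - H n ω (θhat n ω))
        + 1 / 2 * quadF q A u| ≤ κ / 2 * ‖u‖ ^ 2 := by
    intro u hu
    have hu' : ‖u‖ ≤ (n : ℝ) ^ ((3 : ℝ) / 8) := by simpa using hu
    have hT := taylor_two q (H n ω) U hUo hHU (θhat n ω) (((n : ℝ) ^ (-(1 : ℝ) / 2)) • u)
      (fun t ht => hΘU (subset_closure (hin _ (hclose u hu' t ht)))) hgrad
      (quadF q A u) (κ * ‖u‖ ^ 2) ?_
    · rw [one_div_mul_eq_div, div_mul_eq_mul_div]; exact hT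
    intro t ht
    have hd := hclose u hu' t ht
    set θ := θhat n ω + t • ((n : ℝ) ^ (-(1 : ℝ) / 2)) • u with hθ
    have b1 := (abs_quadF_le q (fun i j =>
        (-(1 / (n : ℝ)) * hessEntry q (H n ω) θ i j) - Γ θ i j) u).trans
      (mul_le_mul_of_nonneg_right (hG θ (subset_closure (hin θ hd))) (sq_nonneg _))
    have hΓ2 : frobNorm q (fun i j => Γ θ i j - A i j) < κ / 2 := hΓδ (hd.trans_lt hδa)
    have b2 := (abs_quadF_le q (fun i j => Γ θ i j - A i j) u).trans
      (mul_le_mul_of_nonneg_right hΓ2.le (sq_nonneg _))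
    rw [quadF_sub q (fun i j => -(1 / (n : ℝ)) * hessEntry q (H n ω) θ i j) (fun i j => Γ θ i j),
      quadF_mul q (fun i j => hessEntry q (H n ω) θ i j)] at b1
    rw [quadF_sub q (fun i j => Γ θ i j) A] at b2
    have e : ((n : ℝ) ^ (-(1 : ℝ) / 2)) ^ 2 = 1 / (n : ℝ) := by
      rw [← Real.rpow_natCast, ← Real.rpow_mul hnpos.le]
      norm_num [Real.rpow_neg_one]
    rw [quadF_smul, e]
    change |1 / (n : ℝ) * quadF q (fun i j => hessEntry q (H n ω) θ i j) u + _| ≤ _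
    rw [abs_le] at b1 b2 ⊢
    constructor <;> linarith [b1.1, b1.2, b2.1, b2.2]
  have hfin := integral_compare q A c κ hκ0.le hκc hc _ Metric.isClosed_closedBall.measurableSet
    (fun u => H n ω (θhat n ω + ((n : ℝ) ^ (-(1 : ℝ) / 2)) • u) - H n ω (θhat n ω))
    ((hHm.comp (by fun_prop)).sub_const _) hZb
  have hω' : ε < _ := hω
  rw [hset] at hω'
  rw [Real.dist_eq] at hn1
  have herr' : _ < ε / 2 := herr
  linarith

end
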